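/- arXiv:1712.01343 — 2 statements merged into one kernel-verified Lean document; each statement's English description precedes it below -/
import Mathlib

section
/- Let E be a normed space, 1 ≤ p' < p, and let X_n, X : [0,1] → E be paths such that sup_n ‖X_n‖_{p'-var} ≤ K < ∞ and X_n → X uniformly on [0,1]. Then ‖X_n − X‖_{p-var} → 0 as n → ∞ (and in particular ‖X‖_{p'-var} ≤ K). -/
open Filter Topology Set
open scoped ENNReal

/-- A partition `0 = t_0 ≤ t_1 ≤ … ≤ t_k = 1` of `[0,1]`. -/
def IsPartition {k : ℕ} (t : Fin (k + 1) → ℝ) : Prop :=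
  Monotone t ∧ t 0 = 0 ∧ t (Fin.last k) = 1

/-- The `q`-variation `‖Ξ‖_{q-var}` (valued in `[0,∞]`) of a two-parameter
function `Ξ` over partitions of `[0,1]`:
`(sup_P ∑_{[s,t] ∈ P} ‖Ξ_{s,t}‖^q)^{1/q}`. -/
noncomputable def pVar {E : Type*} [NormedAddCommGroup E] (q : ℝ)
    (Ξ : ℝ → ℝ → E) : ℝ≥0∞ :=
  (⨆ (k : ℕ) (t : { t : Fin (k + 1) → ℝ // IsPartition t }),
    ENNReal.ofReal (∑ i : Fin k, ‖Ξ (t.1 i.castSucc) (t.1 i.succ)‖ ^ q)) ^ (1 / q)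

/-- The `q`-variation of a path `X : [0,1] → E`, i.e. the `q`-variation of its
increments `X_{s,t} = X_t − X_s`. -/
noncomputable def pVarPath {E : Type*} [NormedAddCommGroup E] (q : ℝ)
    (X : ℝ → E) : ℝ≥0∞ :=
  pVar q fun s t => X t - X s

theorem pVarPath_le_iff_aux {E : Type*} [NormedAddCommGroup E] (q C : ℝ) (hq : 0 < q)
    (hC : 0 ≤ C) (X : ℝ → E) :
    pVarPath q X ≤ ENNReal.ofReal C ↔
      ∀ (k : ℕ) (t : Fin (k + 1) → ℝ), IsPartition t →
        ∑ i : Fin k, ‖X (t i.succ) - X (t i.castSucc)‖ ^ q ≤ C ^ q := by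
  unfold pVarPath pVar
  rw [one_div, ENNReal.rpow_inv_le_iff hq, ENNReal.ofReal_rpow_of_nonneg hC hq.le]
  simp only [iSup_le_iff, Subtype.forall]
  refine forall_congr' fun k => forall_congr' fun t => forall_congr' fun ht => ?_
  rw [ENNReal.ofReal_le_ofReal_iff (Real.rpow_nonneg hC q)]

theorem partition_mem_aux {k : ℕ} {t : Fin (k + 1) → ℝ} (ht : IsPartition t)
    (i : Fin (k + 1)) : t i ∈ Icc (0 : ℝ) 1 :=
  ⟨ht.2.1 ▸ ht.1 (Fin.zero_le i), ht.2.2 ▸ ht.1 (Fin.le_last i)⟩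

theorem norm_sub_rpow_aux {E : Type*} [NormedAddCommGroup E] (a b : E) (q : ℝ) (hq : 0 < q) :
    ‖a - b‖ ^ q ≤ 2 ^ q * (‖a‖ ^ q + ‖b‖ ^ q) := by
  have h1 : ‖a - b‖ ≤ 2 * max ‖a‖ ‖b‖ := by
    have := norm_sub_le a b
    linarith [le_max_left ‖a‖ ‖b‖, le_max_right ‖a‖ ‖b‖]
  have h2 : ‖a - b‖ ^ q ≤ (2 * max ‖a‖ ‖b‖) ^ q :=
    Real.rpow_le_rpow (norm_nonneg _) h1 hq.le
  rw [Real.mul_rpow (by norm_num) (by positivity)] at h2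
  refine h2.trans (mul_le_mul_of_nonneg_left ?_ (by positivity))
  have ha : 0 ≤ ‖a‖ ^ q := by positivity
  have hb : 0 ≤ ‖b‖ ^ q := by positivity
  rcases max_cases ‖a‖ ‖b‖ with ⟨h, _⟩ | ⟨h, _⟩ <;> rw [h] <;> linarith

/-- Interpolation: if `sup_n ‖X_n‖_{p'-var} ≤ K` and `X_n → X` uniformly on
`[0,1]`, then for any `p > p'` one has `‖X_n − X‖_{p-var} → 0` (and in
particular `‖X‖_{p'-var} ≤ K`). -/
theorem pvar_interpolation {E : Type*} [NormedAddCommGroup E]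
    (p' p K : ℝ) (hp' : 1 ≤ p') (hp : p' < p)
    (X : ℕ → ℝ → E) (Y : ℝ → E)
    (hvar : ∀ n, pVarPath p' (X n) ≤ ENNReal.ofReal K)
    (hunif : TendstoUniformlyOn X Y atTop (Icc 0 1)) :
    Tendsto (fun n => pVarPath p fun t => X n t - Y t) atTop (𝓝 0) ∧
      pVarPath p' Y ≤ ENNReal.ofReal K := by
  have hp0 : 0 < p' := by linarith
  have hpp : 0 < p := by linarith
  have hd : 0 < p - p' := by linarith
  obtain ⟨C, hC, hKC⟩ : ∃ C : ℝ, 0 ≤ C ∧ ENNReal.ofReal K = ENNReal.ofReal C :=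
    ⟨max K 0, le_max_right _ _, by simp [ENNReal.ofReal_max]⟩
  rw [hKC] at hvar ⊢
  simp only [pVarPath_le_iff_aux p' C hp0 hC] at hvar
  have hY : ∀ (k : ℕ) (t : Fin (k + 1) → ℝ), IsPartition t →
        ∑ i : Fin k, ‖Y (t i.succ) - Y (t i.castSucc)‖ ^ p' ≤ C ^ p' := by
    intro k t ht
    have hlim : ∀ i, Tendsto (fun n => X n (t i)) atTop (𝓝 (Y (t i))) := fun i =>
      hunif.tendsto_at (partition_mem_aux ht i)
    have hs : Tendsto (fun n => ∑ i : Fin k, ‖X n (t i.succ) - X n (t i.castSucc)‖ ^ p') atTop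
        (𝓝 (∑ i : Fin k, ‖Y (t i.succ) - Y (t i.castSucc)‖ ^ p')) :=
      tendsto_finsetSum _ fun i _ =>
        ((hlim _).sub (hlim _)).norm.rpow_const (Or.inr hp0.le)
    exact le_of_tendsto' hs fun n => hvar n k t ht
  refine ⟨?_, (pVarPath_le_iff_aux p' C hp0 hC Y).2 hY⟩
  rw [ENNReal.tendsto_nhds_zero]
  intro ε' hε'
  rcases eq_or_ne ε' ⊤ with rfl | htop
  · simp
  obtain ⟨ε, hε, rfl⟩ : ∃ ε : ℝ, 0 < ε ∧ ε' = ENNReal.ofReal ε :=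
    ⟨ε'.toReal, ENNReal.toReal_pos hε'.ne' htop, (ENNReal.ofReal_toReal htop).symm⟩
  set M : ℝ := 2 ^ p' * (C ^ p' + C ^ p') with hM
  have hM0 : 0 ≤ M := by positivity
  set η : ℝ := (ε ^ p / (M + 1)) ^ (p - p')⁻¹ with hη
  have hη0 : 0 < η := by positivity
  have hηp : η ^ (p - p') = ε ^ p / (M + 1) :=
    Real.rpow_inv_rpow (by positivity) hd.ne'
  filter_upwards [Metric.tendstoUniformlyOn_iff.1 hunif (η / 2) (by positivity)] with n hn
  rw [pVarPath_le_iff_aux p ε hpp hε.le]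
  intro k t ht
  have hsmall : ∀ i, ‖X n (t i) - Y (t i)‖ ≤ η / 2 := fun i => by
    have := hn _ (partition_mem_aux ht i)
    rw [dist_comm, dist_eq_norm] at this
    exact this.le
  have hterm : ∀ i : Fin k,
      ‖X n (t i.succ) - Y (t i.succ) - (X n (t i.castSucc) - Y (t i.castSucc))‖ ^ p ≤
      ε ^ p / (M + 1) * (2 ^ p' * (‖X n (t i.succ) - X n (t i.castSucc)‖ ^ p' +
        ‖Y (t i.succ) - Y (t i.castSucc)‖ ^ p')) := by
    intro i
    have h1 := norm_sub_le (X n (t i.succ) - Y (t i.succ)) (X n (t i.castSucc) - Y (t i.castSucc))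
    have h2 := norm_sub_rpow_aux (X n (t i.succ) - X n (t i.castSucc))
      (Y (t i.succ) - Y (t i.castSucc)) p' hp0
    rw [sub_sub_sub_comm] at h2
    have h3 := hsmall i.succ
    have h4 := hsmall i.castSucc
    set D := ‖X n (t i.succ) - Y (t i.succ) - (X n (t i.castSucc) - Y (t i.castSucc))‖
    have hD0 : 0 ≤ D := norm_nonneg _
    have hD : D ≤ η := by linarith
    have h5 : D ^ p = D ^ (p - p') * D ^ p' := by
      rw [← Real.rpow_add_of_nonneg hD0 hd.le hp0.le]; congr 1; ring
    rw [h5, ← hηp]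
    exact mul_le_mul (Real.rpow_le_rpow hD0 hD hd.le) h2 (by positivity) (by positivity)
  refine (Finset.sum_le_sum fun i _ => hterm i).trans ?_
  rw [← Finset.mul_sum, ← Finset.mul_sum, Finset.sum_add_distrib]
  have hle : 2 ^ p' * (∑ i : Fin k, ‖X n (t i.succ) - X n (t i.castSucc)‖ ^ p' +
        ∑ i : Fin k, ‖Y (t i.succ) - Y (t i.castSucc)‖ ^ p') ≤ M :=
    mul_le_mul_of_nonneg_left (add_le_add (hvar n k t ht) (hY k t ht)) (by positivity)
  have hεp : 0 < ε ^ p := by positivity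
  refine (mul_le_mul_of_nonneg_left hle (by positivity)).trans ?_
  rw [div_mul_eq_mul_div, div_le_iff₀ (by positivity)]
  nlinarith
end

section
/- (Besov–Hölder embedding / Garsia–Rodemich–Rumsey.) Let E be a Banach space, q ∈ [1, ∞), β ∈ (1/q, 1), and let X : [0,1] → E be continuous with Besov seminorm M := (∫_0^1 ∫_0^1 ‖X(t) − X(s)‖^q |t − s|^{−1−βq} ds dt)^{1/q} < ∞. Then there is a constant C depending only on β and q such that ‖X(t) − X(s)‖ ≤ C M |t − s|^{β − 1/q} for all s, t ∈ [0,1]; i.e. X is (β − 1/q)-Hölder with Hölder constant at most C M. -/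
open MeasureTheory Set
open scoped ENNReal

/-- The Besov (Sobolev–Slobodeckij) seminorm
`‖X‖_{W^{β,q}} = (∫_0^1 ∫_0^1 ‖X(t) − X(s)‖^q |t − s|^{−1−βq} ds dt)^{1/q}`,
valued in `[0,∞]`. -/
noncomputable def besovSeminorm {E : Type*} [NormedAddCommGroup E]
    (β q : ℝ) (X : ℝ → E) : ℝ≥0∞ :=
  (∫⁻ s in Icc (0 : ℝ) 1, ∫⁻ t in Icc (0 : ℝ) 1,
    ENNReal.ofReal (‖X t - X s‖ ^ q * |t - s| ^ (-1 - β * q))) ^ (1 / q)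

theorem bhe_pointwise (q β m h a r : ℝ) (hq : 1 < q) (hm : 0 < m) (hh : 0 < h) (ha : 0 ≤ a)
    (hr : 0 < r) (hrh : r ≤ h) (hβ : 0 < β) :
    a ≤ m * h ^ (β - 1 / q) + (m ^ (1 - q) * h ^ (β - 1 / q + 2)) * (a ^ q * r ^ (-1 - β * q)) := by
  set c := m * h ^ (β - 1 / q) with hc
  have hc0 : 0 < c := by positivity
  have h1 : a ≤ c + c ^ (1 - q) * a ^ q := by
    rcases le_total a c with hac | hac
    · have : 0 ≤ c ^ (1 - q) * a ^ q := by positivity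
      linarith
    · have ha0 : 0 < a := by linarith
      have : a ≤ c ^ (1 - q) * a ^ q := by
        have h2 : a ^ (1 - q) ≤ c ^ (1 - q) :=
          Real.rpow_le_rpow_of_nonpos hc0 hac (by linarith)
        calc a = a ^ (1 - q) * a ^ q := by
              rw [← Real.rpow_add ha0]; simp
          _ ≤ _ := by gcongr
      linarith
  have h3 : h ^ (-1 - β * q) ≤ r ^ (-1 - β * q) :=
    Real.rpow_le_rpow_of_nonpos hr hrh (by nlinarith)
  have h4 : c ^ (1 - q) = (m ^ (1 - q) * h ^ (β - 1 / q + 2)) * h ^ (-1 - β * q) := by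
    rw [hc, Real.mul_rpow hm.le (by positivity), ← Real.rpow_mul hh.le, mul_assoc,
      ← Real.rpow_add hh]
    congr 2
    field_simp
    ring
  calc a ≤ c + c ^ (1 - q) * a ^ q := h1
    _ = c + (m ^ (1 - q) * h ^ (β - 1 / q + 2)) * (a ^ q * h ^ (-1 - β * q)) := by
        rw [h4]; ring
    _ ≤ _ := by gcongr

theorem bhe_step {E : Type*} [NormedAddCommGroup E] (q β m : ℝ) (hq : 1 < q) (hβ : 0 < β)
    (hm : 0 < m) (X : ℝ → E) (hX : ContinuousOn X (Icc 0 1))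
    (hK : (∫⁻ s in Icc (0 : ℝ) 1, ∫⁻ t in Icc (0 : ℝ) 1,
      ENNReal.ofReal (‖X t - X s‖ ^ q * |t - s| ^ (-1 - β * q))) ≤ ENNReal.ofReal (m ^ q))
    (x a b a' b' h d : ℝ) (hh : 0 < h) (hab : b - a = h) (hab' : b' - a' = h / 2)
    (ha : 0 ≤ a) (hb : b ≤ 1) (haa : a ≤ a') (hbb : b' ≤ b) (hd : 0 ≤ d)
    (hJ : ∫⁻ u in Icc a' b', ENNReal.ofReal ‖X u - X x‖ ≤ ENNReal.ofReal (d * (h / 2))) :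
    ∫⁻ u in Icc a b, ENNReal.ofReal ‖X u - X x‖ ≤
      ENNReal.ofReal ((d + 3 * m * h ^ (β - 1 / q)) * h) := by
  have hI01 : Icc a b ⊆ Icc (0 : ℝ) 1 := Icc_subset_Icc ha hb
  have hJI : Icc a' b' ⊆ Icc a b := Icc_subset_Icc haa hbb
  set F : ℝ → ℝ → ℝ := fun s t => ‖X t - X s‖ ^ q * |t - s| ^ (-1 - β * q) with hF
  set c := m * h ^ (β - 1 / q) with hc
  set κ := m ^ (1 - q) * h ^ (β - 1 / q + 2) with hκ
  have hc0 : 0 < c := by positivity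
  have hκ0 : 0 < κ := by positivity
  have hF0 : ∀ s t, 0 ≤ F s t := fun s t => by simp only [hF]; positivity
  have hpt : ∀ u ∈ Icc a b, ∀ v ∈ Icc a' b', ENNReal.ofReal ‖X u - X x‖ ≤
      ENNReal.ofReal ‖X v - X x‖ + (ENNReal.ofReal c + ENNReal.ofReal κ * ENNReal.ofReal (F u v)) := by
    intro u hu v hv
    rw [← ENNReal.ofReal_mul hκ0.le, ← ENNReal.ofReal_add hc0.le (mul_nonneg hκ0.le (hF0 _ _)),
      ← ENNReal.ofReal_add (norm_nonneg _)
        (add_nonneg hc0.le (mul_nonneg hκ0.le (hF0 _ _)))]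
    apply ENNReal.ofReal_le_ofReal
    have h1 : ‖X u - X x‖ ≤ ‖X v - X x‖ + ‖X v - X u‖ := by
      have := norm_sub_le (X v - X x) (X v - X u)
      simpa using this
    have h2 : ‖X v - X u‖ ≤ c + κ * F u v := by
      by_cases huv : v = u
      · subst huv
        have := add_nonneg hc0.le (mul_nonneg hκ0.le (hF0 v v))
        simpa using this
      · apply bhe_pointwise q β m h _ _ hq hm hh (norm_nonneg _) (abs_pos.2 (sub_ne_zero.2 huv)) _ hβ
        have hv' := hJI hv
        rw [abs_le]
        constructor <;> linarith [hu.1, hu.2, hv'.1, hv'.2]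
    linarith
  have hmeas : AEMeasurable (fun v => ENNReal.ofReal ‖X v - X x‖) (volume.restrict (Icc a' b')) := by
    apply ENNReal.measurable_ofReal.comp_aemeasurable
    apply ContinuousOn.aemeasurable _ measurableSet_Icc
    exact ((hX.mono (hJI.trans hI01)).sub continuousOn_const).norm
  have hvJ : volume (Icc a' b') = ENNReal.ofReal (h / 2) := by rw [Real.volume_Icc, hab']
  have hvI : volume (Icc a b) = ENNReal.ofReal h := by rw [Real.volume_Icc, hab]
  have hin : ∀ u ∈ Icc a b, ENNReal.ofReal ‖X u - X x‖ * ENNReal.ofReal (h / 2) ≤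
      (ENNReal.ofReal (d * (h / 2)) + ENNReal.ofReal c * ENNReal.ofReal (h / 2)) +
        ENNReal.ofReal κ * ∫⁻ v in Icc (0 : ℝ) 1, ENNReal.ofReal (F u v) := by
    intro u hu
    calc ENNReal.ofReal ‖X u - X x‖ * ENNReal.ofReal (h / 2)
        = ∫⁻ v in Icc a' b', ENNReal.ofReal ‖X u - X x‖ := by
          rw [setLIntegral_const, hvJ]
      _ ≤ ∫⁻ v in Icc a' b', (ENNReal.ofReal ‖X v - X x‖ +
            (ENNReal.ofReal c + ENNReal.ofReal κ * ENNReal.ofReal (F u v))) :=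
          setLIntegral_mono' measurableSet_Icc (hpt u hu)
      _ = (∫⁻ v in Icc a' b', ENNReal.ofReal ‖X v - X x‖) +
            (ENNReal.ofReal c * ENNReal.ofReal (h / 2) +
              ENNReal.ofReal κ * ∫⁻ v in Icc a' b', ENNReal.ofReal (F u v)) := by
          rw [lintegral_add_left' hmeas, lintegral_add_left measurable_const, setLIntegral_const,
            hvJ, lintegral_const_mul' _ _ ENNReal.ofReal_ne_top]
      _ ≤ _ := by
          rw [← add_assoc]
          exact add_le_add (add_le_add hJ le_rfl)
            (mul_le_mul_right (lintegral_mono_set (hJI.trans hI01)) _)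
  have hout : (∫⁻ u in Icc a b, ENNReal.ofReal ‖X u - X x‖) * ENNReal.ofReal (h / 2) ≤
      ENNReal.ofReal (((d + 3 * c) * h) * (h / 2)) := by
    calc (∫⁻ u in Icc a b, ENNReal.ofReal ‖X u - X x‖) * ENNReal.ofReal (h / 2)
        = ∫⁻ u in Icc a b, ENNReal.ofReal ‖X u - X x‖ * ENNReal.ofReal (h / 2) := by
          rw [lintegral_mul_const' _ _ ENNReal.ofReal_ne_top]
      _ ≤ ∫⁻ u in Icc a b, ((ENNReal.ofReal (d * (h / 2)) +
            ENNReal.ofReal c * ENNReal.ofReal (h / 2)) +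
            ENNReal.ofReal κ * ∫⁻ v in Icc (0 : ℝ) 1, ENNReal.ofReal (F u v)) :=
          setLIntegral_mono' measurableSet_Icc hin
      _ = (ENNReal.ofReal (d * (h / 2)) +
            ENNReal.ofReal c * ENNReal.ofReal (h / 2)) * ENNReal.ofReal h +
            ENNReal.ofReal κ * ∫⁻ u in Icc a b, ∫⁻ v in Icc (0 : ℝ) 1, ENNReal.ofReal (F u v) := by
          rw [lintegral_add_left measurable_const, setLIntegral_const, hvI,
            lintegral_const_mul' _ _ ENNReal.ofReal_ne_top]
      _ ≤ (ENNReal.ofReal (d * (h / 2)) +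
            ENNReal.ofReal c * ENNReal.ofReal (h / 2)) * ENNReal.ofReal h +
            ENNReal.ofReal κ * ENNReal.ofReal (m ^ q) := by
          gcongr
          exact (lintegral_mono_set hI01).trans hK
      _ = _ := by
          have e : κ * m ^ q = c * h * h := by
            rw [hκ, hc, Real.rpow_add hh, Real.rpow_sub hm, Real.rpow_one]
            have : m ^ q ≠ 0 := by positivity
            field_simp
            norm_num
          rw [← ENNReal.ofReal_mul hc0.le, ← ENNReal.ofReal_add (by positivity) (by positivity),
            ← ENNReal.ofReal_mul (by positivity), ← ENNReal.ofReal_mul hκ0.le, e,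
            ← ENNReal.ofReal_add (by positivity) (by positivity)]
          congr 1
          ring
  rw [ENNReal.ofReal_mul (by positivity)] at hout
  have := (ENNReal.mul_le_mul_iff_left (c := ENNReal.ofReal (h / 2))
    (by simpa using hh) ENNReal.ofReal_ne_top).1 hout
  rw [mul_assoc 3 m]
  exact this

theorem bhe_avg {E : Type*} [NormedAddCommGroup E] (q β m : ℝ) (hq : 1 < q) (hβ : 1 / q < β)
    (hm : 0 < m) (X : ℝ → E) (hX : ContinuousOn X (Icc 0 1))
    (hK : (∫⁻ s in Icc (0 : ℝ) 1, ∫⁻ t in Icc (0 : ℝ) 1,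
      ENNReal.ofReal (‖X t - X s‖ ^ q * |t - s| ^ (-1 - β * q))) ≤ ENNReal.ofReal (m ^ q))
    (x θ ε : ℝ) (hx : x ∈ Icc (0 : ℝ) 1) (hθ : θ ∈ Icc (0 : ℝ) 1) (hε : 0 < ε)
    (L : ℝ) (hL : 0 ≤ L) (hLm : L * (1 / 2) ^ (β - 1 / q) + 3 * m = L)
    (h : ℝ) (hh : 0 < h) (h0 : 0 ≤ x - θ * h) (h1 : x + (1 - θ) * h ≤ 1) :
    ∫⁻ u in Icc (x - θ * h) (x + (1 - θ) * h), ENNReal.ofReal ‖X u - X x‖ ≤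
      ENNReal.ofReal ((ε + L * h ^ (β - 1 / q)) * h) := by
  have hβ0 : 0 < β := lt_trans (by positivity) hβ
  obtain ⟨δ, hδ, hδX⟩ := Metric.continuousOn_iff.1 hX x hx ε hε
  have key : ∀ n : ℕ, ∀ h : ℝ, 0 < h → 0 ≤ x - θ * h → x + (1 - θ) * h ≤ 1 →
      h * (1 / 2) ^ n < δ →
      ∫⁻ u in Icc (x - θ * h) (x + (1 - θ) * h), ENNReal.ofReal ‖X u - X x‖ ≤
        ENNReal.ofReal ((ε + L * h ^ (β - 1 / q)) * h) := by
    intro n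
    induction n with
    | zero =>
      intro h hh h0 h1 hn
      have hn' : h < δ := by simpa using hn
      calc ∫⁻ u in Icc (x - θ * h) (x + (1 - θ) * h), ENNReal.ofReal ‖X u - X x‖
          ≤ ∫⁻ u in Icc (x - θ * h) (x + (1 - θ) * h), ENNReal.ofReal ε := by
            apply setLIntegral_mono' measurableSet_Icc
            intro u hu
            apply ENNReal.ofReal_le_ofReal
            rw [← dist_eq_norm]
            refine (hδX u ⟨h0.trans hu.1, hu.2.trans h1⟩ ?_).le
            rw [Real.dist_eq, abs_lt]
            constructor <;> nlinarith [hu.1, hu.2, hθ.1, hθ.2]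
        _ = ENNReal.ofReal (ε * h) := by
            rw [setLIntegral_const, Real.volume_Icc, ← ENNReal.ofReal_mul hε.le]
            congr 2
            ring
        _ ≤ _ := by
            apply ENNReal.ofReal_le_ofReal
            have : 0 ≤ L * h ^ (β - 1 / q) := by positivity
            nlinarith
    | succ n ih =>
      intro h hh h0 h1 hn
      have hθh : 0 ≤ θ * h := mul_nonneg hθ.1 hh.le
      have hθh' : 0 ≤ (1 - θ) * h := mul_nonneg (by linarith [hθ.2]) hh.le
      have hJ := ih (h / 2) (by positivity) (by linarith) (by linarith)
        (by rw [pow_succ] at hn; linarith)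
      have := bhe_step q β m hq hβ0 hm X hX hK x (x - θ * h) (x + (1 - θ) * h)
        (x - θ * (h / 2)) (x + (1 - θ) * (h / 2)) h (ε + L * (h / 2) ^ (β - 1 / q)) hh
        (by ring) (by ring) h0 h1 (by linarith) (by linarith) (by positivity) hJ
      refine this.trans_eq ?_
      congr 2
      have e : (h / 2) ^ (β - 1 / q) = (1 / 2) ^ (β - 1 / q) * h ^ (β - 1 / q) := by
        rw [← Real.mul_rpow (by norm_num) hh.le]
        congr 1
        ring
      rw [e]
      nth_rewrite 2 [← hLm]
      ring
  obtain ⟨n, hn⟩ := exists_pow_lt_of_lt_one (div_pos hδ hh) (show (1 / 2 : ℝ) < 1 by norm_num)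
  refine key n h hh h0 h1 ?_
  rw [lt_div_iff₀ hh] at hn
  linarith

theorem bhe_main {E : Type*} [NormedAddCommGroup E] (q β m : ℝ) (hq : 1 < q) (hβ : 1 / q < β)
    (hm : 0 < m) (X : ℝ → E) (hX : ContinuousOn X (Icc 0 1))
    (hK : (∫⁻ s in Icc (0 : ℝ) 1, ∫⁻ t in Icc (0 : ℝ) 1,
      ENNReal.ofReal (‖X t - X s‖ ^ q * |t - s| ^ (-1 - β * q))) ≤ ENNReal.ofReal (m ^ q))
    (L : ℝ) (hL : 0 ≤ L) (hLm : L * (1 / 2) ^ (β - 1 / q) + 3 * m = L)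
    (s t : ℝ) (hs : s ∈ Icc (0 : ℝ) 1) (ht : t ∈ Icc (0 : ℝ) 1) (hst : s < t) :
    ‖X t - X s‖ ≤ 2 * L * (t - s) ^ (β - 1 / q) := by
  have hh : 0 < t - s := sub_pos.2 hst
  set h := t - s with hdef
  apply le_of_forall_pos_le_add
  intro ε hε
  have hs' := bhe_avg q β m hq hβ hm X hX hK s 0 (ε / 2) hs (by simp) (by positivity) L hL hLm
    h hh (by linarith [hs.1]) (by linarith [ht.2])
  have ht' := bhe_avg q β m hq hβ hm X hX hK t 1 (ε / 2) ht (by simp) (by positivity) L hL hLm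
    h hh (by linarith [hs.1]) (by linarith [ht.2])
  rw [show s - 0 * h = s by ring, show s + (1 - 0) * h = t by rw [hdef]; ring] at hs'
  rw [show t - 1 * h = s by rw [hdef]; ring, show t + (1 - 1) * h = t by ring] at ht'
  have hmeas : AEMeasurable (fun v => ENNReal.ofReal ‖X v - X t‖) (volume.restrict (Icc s t)) := by
    apply ENNReal.measurable_ofReal.comp_aemeasurable
    apply ContinuousOn.aemeasurable _ measurableSet_Icc
    exact ((hX.mono (Icc_subset_Icc hs.1 ht.2)).sub continuousOn_const).norm
  have : ENNReal.ofReal (‖X t - X s‖ * h) ≤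
      ENNReal.ofReal (2 * ((ε / 2 + L * h ^ (β - 1 / q)) * h)) := by
    calc ENNReal.ofReal (‖X t - X s‖ * h) = ∫⁻ u in Icc s t, ENNReal.ofReal ‖X t - X s‖ := by
          rw [setLIntegral_const, Real.volume_Icc, ← ENNReal.ofReal_mul (norm_nonneg _)]
      _ ≤ ∫⁻ u in Icc s t, (ENNReal.ofReal ‖X u - X t‖ + ENNReal.ofReal ‖X u - X s‖) := by
          apply lintegral_mono
          intro u
          dsimp only
          rw [← ENNReal.ofReal_add (norm_nonneg _) (norm_nonneg _)]
          apply ENNReal.ofReal_le_ofReal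
          have := norm_sub_le (X u - X s) (X u - X t)
          rw [show X u - X s - (X u - X t) = X t - X s by abel] at this
          linarith
      _ = _ := lintegral_add_left' hmeas _
      _ ≤ _ := add_le_add ht' hs'
      _ = _ := by
          rw [← ENNReal.ofReal_add (by positivity) (by positivity)]
          congr 1
          ring
  have h2 := (ENNReal.ofReal_le_ofReal_iff (by positivity)).1 this
  have h3 : ‖X t - X s‖ * h ≤ (2 * L * h ^ (β - 1 / q) + ε) * h := by linarith
  exact le_of_mul_le_mul_right h3 hh

/-- **Besov–Hölder embedding (Garsia–Rodemich–Rumsey).** For `q ∈ [1,∞)` and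
`β ∈ (1/q, 1)` there is a constant `C = C(β, q)` such that every continuous
path `X : [0,1] → E` (into a Banach space) with finite Besov seminorm `M`
satisfies `‖X(t) − X(s)‖ ≤ C M |t − s|^{β − 1/q}` for all `s, t ∈ [0,1]`. -/
theorem besov_holder_embedding (q β : ℝ) (hq : 1 ≤ q) (hβl : 1 / q < β)
    (hβu : β < 1) :
    ∃ C : ℝ, 0 < C ∧
      ∀ (E : Type) [NormedAddCommGroup E] [NormedSpace ℝ E] [CompleteSpace E],
        ∀ X : ℝ → E, ContinuousOn X (Icc 0 1) →
          besovSeminorm β q X < ⊤ →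
          ∀ s ∈ Icc (0 : ℝ) 1, ∀ t ∈ Icc (0 : ℝ) 1,
            ‖X t - X s‖ ≤ C * (besovSeminorm β q X).toReal * |t - s| ^ (β - 1 / q) := by
  have hq1 : 1 < q := by
    have h1 : 1 / q < 1 := hβl.trans hβu
    rwa [div_lt_one (by linarith)] at h1
  have hq0 : 0 < q := by linarith
  have hγ : 0 < β - 1 / q := by linarith
  have hρ : (1 / 2 : ℝ) ^ (β - 1 / q) < 1 := Real.rpow_lt_one (by norm_num) (by norm_num) hγ
  set ρ := (1 / 2 : ℝ) ^ (β - 1 / q) with hρd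
  have hρ1 : 0 < 1 - ρ := by linarith
  refine ⟨6 / (1 - ρ), by positivity, ?_⟩
  intro E _ _ _ X hX hfin
  have main : ∀ s ∈ Icc (0 : ℝ) 1, ∀ t ∈ Icc (0 : ℝ) 1, s < t →
      ‖X t - X s‖ ≤ 6 / (1 - ρ) * (besovSeminorm β q X).toReal * (t - s) ^ (β - 1 / q) := by
    intro s hs t ht hst
    set M := (besovSeminorm β q X).toReal with hM
    have hM0 : 0 ≤ M := ENNReal.toReal_nonneg
    have hmain : ∀ m, M < m →
        ‖X t - X s‖ ≤ 6 / (1 - ρ) * m * (t - s) ^ (β - 1 / q) := by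
      intro m hm
      have hm0 : 0 < m := lt_of_le_of_lt hM0 hm
      have hK : (∫⁻ s in Icc (0 : ℝ) 1, ∫⁻ t in Icc (0 : ℝ) 1,
          ENNReal.ofReal (‖X t - X s‖ ^ q * |t - s| ^ (-1 - β * q))) ≤ ENNReal.ofReal (m ^ q) := by
        have h1 : besovSeminorm β q X ≤ ENNReal.ofReal m := by
          rw [← ENNReal.ofReal_toReal hfin.ne]
          exact ENNReal.ofReal_le_ofReal hm.le
        unfold besovSeminorm at h1
        rw [← ENNReal.ofReal_rpow_of_pos hm0]
        rw [one_div] at h1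
        exact (ENNReal.rpow_inv_le_iff hq0).1 h1
      have := bhe_main q β m hq1 hβl hm0 X hX hK (3 * m / (1 - ρ)) (by positivity)
        (by rw [← hρd]; field_simp; ring) s t hs ht hst
      refine this.trans_eq ?_
      ring
    have hlim : Filter.Tendsto (fun m : ℝ => 6 / (1 - ρ) * m * (t - s) ^ (β - 1 / q))
        (nhdsWithin M (Ioi M)) (nhds (6 / (1 - ρ) * M * (t - s) ^ (β - 1 / q))) := by
      apply Filter.Tendsto.mono_left _ nhdsWithin_le_nhds
      exact Continuous.tendsto (by fun_prop) M
    exact ge_of_tendsto hlim (Filter.eventually_of_mem self_mem_nhdsWithin hmain)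
  intro s hs t ht
  rcases lt_trichotomy s t with h | h | h
  · rw [abs_of_pos (sub_pos.2 h)]
    exact main s hs t ht h
  · subst h
    rw [sub_self, sub_self, abs_zero, norm_zero, Real.zero_rpow hγ.ne', mul_zero]
  · rw [abs_sub_comm, abs_of_pos (sub_pos.2 h), norm_sub_rev]
    exact main t ht s hs h
end
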